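/- Let 𝒞 be a Cartan scheme with a root system ℛ of type 𝒞, let X, Y ∈ 𝒳, let w ∈ Hom(Y,X), and let (i_1,…,i_m) be any word based at X with endpoint Y whose automorphism equals that of w (not necessarily reduced). Then {β ∈ Δ^X_+ : the number of indices k ∈ {1,…,m} with β_k = β or β_k = −β is odd} = R_w. -/

import Mathlib

noncomputable section

open scoped BigOperators

namespace WeylGpd

/-- A Cartan scheme: objects `X`, reflection maps `r_i`, and generalized Cartan matrices `A^X`
with `a^{r_i(X)}_{ij} = a^X_{ij}`. -/
structure CartanScheme (n : ℕ) where
  X : Type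
  nonempty : Nonempty X
  r : Fin n → X → X
  r_invol : ∀ i x, r i (r i x) = x
  A : X → Matrix (Fin n) (Fin n) ℤ
  A_diag : ∀ x i, A x i i = 2
  A_nonpos : ∀ x i j, i ≠ j → A x i j ≤ 0
  A_zero_iff : ∀ x i j, A x i j = 0 ↔ A x j i = 0
  A_r : ∀ x i j, A (r i x) i j = A x i j

variable {n : ℕ}

/-- The standard basis vector `α_i` of `ℤ^I`. -/
def alphav (n : ℕ) (i : Fin n) : Fin n → ℤ := Pi.single i 1

/-- The vectors with all coordinates nonnegative. -/
def Epos (n : ℕ) : Set (Fin n → ℤ) := {v | ∀ i, 0 ≤ v i}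

/-- The reflection `s_i^X`, `s_i^X(α_j) = α_j − a^X_{ij} α_i`, extended linearly. -/
def sMap (C : CartanScheme n) (i : Fin n) (x : C.X) (v : Fin n → ℤ) : Fin n → ℤ :=
  v - (∑ j, C.A x i j * v j) • alphav n i

/-- The endpoint `X_{m+1}` of a word `(i_1, …, i_m)` based at `x`. -/
def wordEnd (C : CartanScheme n) : C.X → List (Fin n) → C.X
  | x, [] => x
  | x, (i :: w) => wordEnd C (C.r i x) w

/-- The automorphism `s_{i_1}^{X_1} ∘ ⋯ ∘ s_{i_m}^{X_m}` of a word based at `x`. -/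
def wordMap (C : CartanScheme n) : C.X → List (Fin n) → (Fin n → ℤ) → (Fin n → ℤ)
  | _, [] => id
  | x, (i :: w) => sMap C i x ∘ wordMap C (C.r i x) w

/-- The roots `β_j = s_{i_1} ⋯ s_{i_{j-1}} (α_{i_j})` of a word based at `x` (0-indexed). -/
def wordRoot (C : CartanScheme n) (x : C.X) (w : List (Fin n)) (j : Fin w.length) :
    Fin n → ℤ :=
  wordMap C x (w.take j) (alphav n (w.get j))

/-- A root system of type `𝒞`. -/
structure RootSystem (C : CartanScheme n) where
  Δ : C.X → Set (Fin n → ℤ)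
  pos_neg : ∀ x, Δ x = (Δ x ∩ Epos n) ∪ (-(Δ x ∩ Epos n))
  simple : ∀ x i, Δ x ∩ {v | ∃ m : ℤ, v = m • alphav n i} = {alphav n i, -alphav n i}
  s_invariant : ∀ x i, sMap C i x '' Δ x = Δ (C.r i x)
  rank_two_finite : ∀ x i j, i ≠ j →
    (Δ x ∩ {v | ∃ a b : ℕ, v = (a : ℤ) • alphav n i + (b : ℤ) • alphav n j}).Finite
  rank_two : ∀ x i j, i ≠ j →
    ((C.r i) ∘ (C.r j))^[(Δ x ∩
      {v | ∃ a b : ℕ, v = (a : ℤ) • alphav n i + (b : ℤ) • alphav n j}).ncard] x = x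

/-- Positive roots at `x`. -/
def RootSystem.pos {C : CartanScheme n} (R : RootSystem C) (x : C.X) : Set (Fin n → ℤ) :=
  R.Δ x ∩ Epos n

/-- `(φ, (y, x))` is realized by the word `w` based at `x` with endpoint `y`. -/
def IsWord (C : CartanScheme n) (x y : C.X) (φ : (Fin n → ℤ) → (Fin n → ℤ))
    (w : List (Fin n)) : Prop :=
  wordEnd C x w = y ∧ wordMap C x w = φ

/-- `(φ, (y, x))` is a morphism of the Weyl groupoid, i.e. `Hom(y, x) ∋ φ`. -/
def IsHom (C : CartanScheme n) (x y : C.X) (φ : (Fin n → ℤ) → (Fin n → ℤ)) : Prop :=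
  ∃ w : List (Fin n), IsWord C x y φ w

/-- The length `ℓ(w)` of a morphism. -/
def hlen (C : CartanScheme n) (x y : C.X) (φ : (Fin n → ℤ) → (Fin n → ℤ)) : ℕ :=
  sInf {m | ∃ w : List (Fin n), w.length = m ∧ IsWord C x y φ w}

/-- `w` is a reduced expression of the morphism `(φ, (y, x))`. -/
def IsReduced (C : CartanScheme n) (x y : C.X) (φ : (Fin n → ℤ) → (Fin n → ℤ))
    (w : List (Fin n)) : Prop :=
  IsWord C x y φ w ∧ w.length = hlen C x y φ

/-- `R_w = {α ∈ Δ^X_+ : w^{-1}(α) ∈ Δ^Y_-}`, phrased as `α = w(δ)` for a negative root `δ`. -/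
def Rset (C : CartanScheme n) (R : RootSystem C) (x y : C.X)
    (φ : (Fin n → ℤ) → (Fin n → ℤ)) : Set (Fin n → ℤ) :=
  {α | α ∈ R.pos x ∧ ∃ γ ∈ R.pos y, φ (-γ) = α}

end WeylGpd

namespace WeylGpd

theorem sMap_neg {n : ℕ} (C : CartanScheme n) (i : Fin n) (x : C.X) (v : Fin n → ℤ) :
    sMap C i x (-v) = -sMap C i x v := by
  simp only [sMap, Pi.neg_apply, mul_neg, Finset.sum_neg_distrib, neg_smul]
  abel

theorem sMap_alphav {n : ℕ} (C : CartanScheme n) (i : Fin n) (x : C.X) :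
    sMap C i x (alphav n i) = -alphav n i := by
  have h : ∑ j, C.A x i j * alphav n i j = 2 := by
    simp [alphav, Pi.single_apply, C.A_diag]
  rw [sMap, h, two_smul]
  abel

theorem sMap_apply_of_ne {n : ℕ} (C : CartanScheme n) {i j : Fin n} (hij : j ≠ i) (x : C.X)
    (v : Fin n → ℤ) : sMap C i x v j = v j := by
  simp [sMap, alphav, hij]

theorem sMap_sMap {n : ℕ} (C : CartanScheme n) (i : Fin n) (x : C.X) (v : Fin n → ℤ) :
    sMap C i x (sMap C i x v) = v := by
  have h : ∑ j, C.A x i j * sMap C i x v j = -∑ j, C.A x i j * v j := by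
    simp only [sMap, Pi.sub_apply, Pi.smul_apply, smul_eq_mul, mul_sub, Finset.sum_sub_distrib]
    have : ∑ k, C.A x i k * ((∑ j, C.A x i j * v j) * alphav n i k) =
        2 * ∑ j, C.A x i j * v j := by
      simp [alphav, Pi.single_apply, C.A_diag]
    rw [this]
    ring
  rw [sMap, h, sMap, neg_smul]
  abel

theorem sMap_injective {n : ℕ} (C : CartanScheme n) (i : Fin n) (x : C.X) :
    Function.Injective (sMap C i x) :=
  Function.Involutive.injective (sMap_sMap C i x)

theorem sMap_r {n : ℕ} (C : CartanScheme n) (i : Fin n) (x : C.X) :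
    sMap C i (C.r i x) = sMap C i x := by
  funext v
  simp only [sMap, C.A_r]

namespace RootSystem

variable {n : ℕ} {C : CartanScheme n} (R : RootSystem C)

theorem mem_Epos_or {x : C.X} {β : Fin n → ℤ} (hβ : β ∈ R.Δ x) : β ∈ Epos n ∨ -β ∈ Epos n := by
  rw [R.pos_neg] at hβ
  exact hβ.imp (fun h => h.2) (fun h => h.2)

theorem neg_mem {x : C.X} {β : Fin n → ℤ} (hβ : β ∈ R.Δ x) : -β ∈ R.Δ x := by
  rw [R.pos_neg] at hβ
  rcases hβ with h | h
  · rw [R.pos_neg]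
    exact Or.inr (by simpa using h)
  · exact h.1

theorem sMap_mem {x : C.X} (i : Fin n) {β : Fin n → ℤ} (hβ : β ∈ R.Δ x) :
    sMap C i x β ∈ R.Δ (C.r i x) := by
  rw [← R.s_invariant]
  exact ⟨β, hβ, rfl⟩

theorem sMap_mem_of_r {x : C.X} (i : Fin n) {β : Fin n → ℤ} (hβ : β ∈ R.Δ (C.r i x)) :
    sMap C i x β ∈ R.Δ x := by
  have h := R.sMap_mem i hβ
  rwa [sMap_r, C.r_invol] at h

theorem eq_alphav_or_of_forall_ne {x : C.X} {i : Fin n} {β : Fin n → ℤ} (hβ : β ∈ R.Δ x)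
    (h : ∀ j, j ≠ i → β j = 0) : β = alphav n i ∨ β = -alphav n i := by
  have hm : β ∈ R.Δ x ∩ {v | ∃ m : ℤ, v = m • alphav n i} := by
    refine ⟨hβ, β i, ?_⟩
    funext j
    by_cases hj : j = i
    · subst hj
      simp [alphav]
    · simp [alphav, hj, h j hj]
  rw [R.simple] at hm
  exact hm

theorem alphav_mem_Epos (i : Fin n) : alphav n i ∈ Epos n := fun j => by
  by_cases hj : j = i
  · subst hj
    simp [alphav]
  · simp [alphav, hj]

theorem neg_alphav_notMem_Epos (i : Fin n) : -alphav n i ∉ Epos n := fun h => by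
  have := h i
  simp [alphav] at this

theorem neg_notMem_Epos (hn : 1 ≤ n) {x : C.X} {β : Fin n → ℤ} (hβ : β ∈ R.Δ x)
    (hp : β ∈ Epos n) : -β ∉ Epos n := fun h => by
  have h0 : ∀ j, β j = 0 := fun j => le_antisymm (by simpa using h j) (hp j)
  let i : Fin n := ⟨0, hn⟩
  rcases R.eq_alphav_or_of_forall_ne (i := i) hβ (fun j _ => h0 j) with e | e <;>
  · have := h0 i
    rw [e] at this
    simp [alphav] at this

theorem sMap_mem_Epos {x : C.X} {i : Fin n} {β : Fin n → ℤ} (hβ : β ∈ R.Δ x) (hp : β ∈ Epos n)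
    (hne : β ≠ alphav n i) : sMap C i x β ∈ Epos n := by
  refine (R.mem_Epos_or (R.sMap_mem i hβ)).resolve_right fun hneg => ?_
  have h0 : ∀ j, j ≠ i → β j = 0 := fun j hj => by
    have h := hneg j
    rw [Pi.neg_apply, sMap_apply_of_ne C hj] at h
    exact le_antisymm (by linarith) (hp j)
  rcases R.eq_alphav_or_of_forall_ne hβ h0 with e | e
  · exact hne e
  · exact neg_alphav_notMem_Epos i (e ▸ hp)

/-- A simple reflection preserves the sign of every root except `±α_i`. -/
theorem sMap_mem_Epos_iff (hn : 1 ≤ n) {x : C.X} {i : Fin n} {β : Fin n → ℤ} (hβ : β ∈ R.Δ x) :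
    (sMap C i x β ∈ Epos n ↔ β ∈ Epos n) ↔ ¬(alphav n i = β ∨ alphav n i = -β) := by
  by_cases h : alphav n i = β ∨ alphav n i = -β
  · have ha := alphav_mem_Epos i
    have hna := neg_alphav_notMem_Epos i
    rcases h with rfl | h
    · simp [sMap_alphav, ha, hna]
    · obtain rfl : β = -alphav n i := by rw [h, neg_neg]
      simp [sMap_neg, sMap_alphav, ha, hna]
  · simp only [h, not_false_eq_true, iff_true]
    push Not at h
    by_cases hp : β ∈ Epos n
    · simp [hp, R.sMap_mem_Epos hβ hp (Ne.symm h.1)]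
    · have hp' := (R.mem_Epos_or hβ).resolve_left hp
      have h2 := R.sMap_mem_Epos (R.neg_mem hβ) hp' (Ne.symm h.2)
      have h3 := R.neg_notMem_Epos hn (R.sMap_mem i (R.neg_mem hβ)) h2
      rw [sMap_neg, neg_neg] at h3
      simp [hp, h3]

theorem wordMap_mem (w : List (Fin n)) (x : C.X) {γ : Fin n → ℤ} (hγ : γ ∈ R.Δ (wordEnd C x w)) :
    wordMap C x w γ ∈ R.Δ x := by
  induction w generalizing x with
  | nil => exact hγ
  | cons i w ih => exact R.sMap_mem_of_r i (ih _ hγ)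

theorem exists_wordMap_eq (w : List (Fin n)) (x : C.X) {β : Fin n → ℤ} (hβ : β ∈ R.Δ x) :
    ∃ γ ∈ R.Δ (wordEnd C x w), wordMap C x w γ = β := by
  induction w generalizing x β with
  | nil => exact ⟨β, hβ, rfl⟩
  | cons i w ih =>
    obtain ⟨γ, hγ, h⟩ := ih _ (R.sMap_mem i hβ)
    exact ⟨γ, hγ, by simp only [wordMap, Function.comp_apply, h, sMap_sMap]⟩

/-- The roots `±β` occur an odd number of times along a word exactly when the automorphism of
the word changes the sign of the root mapped to `β`. -/
theorem odd_card_wordRoot_iff (hn : 1 ≤ n) (w : List (Fin n)) (x : C.X) {γ : Fin n → ℤ}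
    (hγ : γ ∈ R.Δ (wordEnd C x w)) :
    Odd (Finset.univ.filter (fun j : Fin w.length => wordRoot C x w j = wordMap C x w γ ∨
      wordRoot C x w j = -wordMap C x w γ)).card ↔
      ¬(wordMap C x w γ ∈ Epos n ↔ γ ∈ Epos n) := by
  induction w generalizing x with
  | nil => simp [wordMap]
  | cons i w ih =>
    have ih := ih (C.r i x) hγ
    have hβ := R.wordMap_mem w (C.r i x) hγ
    set β := wordMap C (C.r i x) w γ
    have hsign := R.sMap_mem_Epos_iff hn (i := i) (R.sMap_mem_of_r i hβ)
    rw [sMap_sMap] at hsign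
    have hmap : wordMap C x (i :: w) γ = sMap C i x β := rfl
    have hzero : wordRoot C x (i :: w) (0 : Fin (w.length + 1)) = alphav n i := rfl
    have hsucc : ∀ j : Fin w.length, wordRoot C x (i :: w) j.succ =
        sMap C i x (wordRoot C (C.r i x) w j) := fun _ => rfl
    have hcard := Fin.card_filter_univ_succ (fun j : Fin (w.length + 1) =>
      wordRoot C x (i :: w) j = sMap C i x β ∨ wordRoot C x (i :: w) j = -sMap C i x β)
    simp only [hzero, hsucc, ← sMap_neg, (sMap_injective C i x).eq_iff] at hcard
    rw [hmap]
    simp only [← sMap_neg] at hsign ⊢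
    refine (iff_of_eq (congrArg Odd hcard)).trans ?_
    split_ifs with h
    · rw [Nat.odd_add_one, ih]
      tauto
    · rw [ih]
      tauto

end RootSystem

/-- For any (not necessarily reduced) word realizing `w ∈ Hom(Y, X)`, the set of
positive roots `β` occurring an odd number of times among `±β_1, …, ±β_m` equals `R_w`. -/
theorem stmt1 {n : ℕ} (hn : 1 ≤ n) (C : CartanScheme n) (R : RootSystem C)
    (x y : C.X) (φ : (Fin n → ℤ) → (Fin n → ℤ))
    (w : List (Fin n)) (hw : IsWord C x y φ w) :
    {β | β ∈ R.pos x ∧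
        Odd (Finset.univ.filter
          (fun j : Fin w.length => wordRoot C x w j = β ∨ wordRoot C x w j = -β)).card} =
      Rset C R x y φ := by
  obtain ⟨rfl, rfl⟩ := hw
  ext β
  constructor
  · rintro ⟨hβ, hodd⟩
    obtain ⟨γ, hγ, rfl⟩ := R.exists_wordMap_eq w x hβ.1
    rw [R.odd_card_wordRoot_iff hn w x hγ] at hodd
    have hγn : γ ∉ Epos n := fun h => hodd (iff_of_true hβ.2 h)
    exact ⟨hβ, -γ, ⟨R.neg_mem hγ, (R.mem_Epos_or hγ).resolve_left hγn⟩, by rw [neg_neg]⟩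
  · rintro ⟨hβ, γ, hγ, rfl⟩
    refine ⟨hβ, (R.odd_card_wordRoot_iff hn w x (R.neg_mem hγ.1)).2 fun h => ?_⟩
    exact R.neg_notMem_Epos hn hγ.1 hγ.2 (h.1 hβ.2)

end WeylGpd
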